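/- arXiv:1712.06152 — 3 statements merged into one kernel-verified Lean document; each statement's English description precedes it below -/
import Mathlib

section
/- Let G be a countably infinite discrete amenable group acting continuously on a compact Hausdorff space X, and let {F_n} be any tempered Følner sequence in G. Then the Bowen (dimensional) topological entropy of the whole space equals the usual topological entropy: h^B_top(X,{F_n}) = h_top(X,G). -/
/-!
Bowen (dimensional) topological entropy for actions of countably infinite amenable groups,
and the theorem that it equals the usual topological entropy along any tempered Følner
sequence (Theorem 1.1 of Dou–Zhang).
-/

open Filter Topology Pointwise Set
open scoped ENNReal NNReal

section Defs

variable {G : Type*} [Group G] [DecidableEq G]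

/-- `F` is a (left) Følner sequence: each `F n` is nonempty and
`|F n ∆ gF n| / |F n| → 0` for every `g ∈ G`. -/
def IsFolnerSeq (F : ℕ → Finset G) : Prop :=
  (∀ n, (F n).Nonempty) ∧
    ∀ g : G, Filter.Tendsto
      (fun n => ((symmDiff (F n) ((F n).image (fun h => g * h))).card : ℝ) / ((F n).card : ℝ))
      Filter.atTop (nhds 0)

/-- `F` is tempered: there is `C > 0` with `|⋃_{k<n} (F k)⁻¹ (F n)| ≤ C |F n|` for all `n`. -/
def IsTemperedSeq (F : ℕ → Finset G) : Prop :=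
  ∃ C : ℝ, 0 < C ∧ ∀ n : ℕ,
    ((((Finset.range n).biUnion fun k => (F k)⁻¹ * F n)).card : ℝ) ≤ C * ((F n).card : ℝ)

variable {X : Type*} [TopologicalSpace X] [MulAction G X]

/-- The set `X(U) = ⋂_{g ∈ F} g⁻¹ U_g` associated to a `(𝒰,F)`-name `u`. -/
def nameSet (F : Finset G) (u : G → Set X) : Set X := {x : X | ∀ g ∈ F, g • x ∈ u g}

/-- `𝒰` is a finite open cover of the set `Z`. -/
def IsFiniteOpenCoverOn (𝒰 : Finset (Set X)) (Z : Set X) : Prop :=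
  (∀ V ∈ 𝒰, IsOpen V) ∧ Z ⊆ ⋃₀ (𝒰 : Set (Set X))

/-- `N(⋁_{g ∈ F} g⁻¹ 𝒰)` relative to `Z` : the minimal cardinality of a family of
`(𝒰,F)`-names whose associated sets cover `Z`. -/
noncomputable def covNum (𝒰 : Finset (Set X)) (F : Finset G) (Z : Set X) : ℕ :=
  sInf {k : ℕ | ∃ Λ : Finset (G → Set X), Λ.card = k ∧
    (∀ u ∈ Λ, ∀ g ∈ F, u g ∈ 𝒰) ∧ Z ⊆ ⋃ u ∈ Λ, nameSet F u}

/-- The entropy of the cover `𝒰` along the Følner sequence `Fseq`,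
`lim_n (1/|F n|) log N(⋁_{g ∈ F n} g⁻¹𝒰)` (the limit exists by the Ornstein–Weiss lemma,
so we may express it as a `limsup`). -/
noncomputable def coverEntropyOf (Fseq : ℕ → Finset G) (𝒰 : Finset (Set X)) (Z : Set X) :
    ℝ≥0∞ :=
  Filter.limsup
    (fun n => ENNReal.ofReal (Real.log (covNum 𝒰 (Fseq n) Z) / ((Fseq n).card : ℝ)))
    Filter.atTop

/-- The topological entropy `h_top(X,G) = sup_𝒰 lim_n (1/|F n|) log N(⋁_{g∈F n} g⁻¹𝒰)`,
the supremum over all finite open covers `𝒰` of `X`. -/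
noncomputable def topEntropy (X : Type*) [TopologicalSpace X] [MulAction G X]
    (Fseq : ℕ → Finset G) : ℝ≥0∞ :=
  ⨆ (𝒰 : Finset (Set X)) (_ : IsFiniteOpenCoverOn 𝒰 (Set.univ : Set X)),
    coverEntropyOf Fseq 𝒰 (Set.univ : Set X)

/-- `ℳ(Z,𝒰,N,s,{F n})`: the infimum of `∑_{U ∈ Λ} exp(-s·m(U))` over all collections `Λ`
of `(𝒰, F j)`-names with `j ≥ N` whose associated sets cover `Z`. -/
noncomputable def bowenM (Fseq : ℕ → Finset G) (𝒰 : Finset (Set X)) (Z : Set X)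
    (N : ℕ) (s : ℝ) : ℝ≥0∞ :=
  ⨅ (Λ : Set (ℕ × (G → Set X)))
    (_ : ∀ p ∈ Λ, N ≤ p.1 ∧ ∀ g ∈ Fseq p.1, p.2 g ∈ 𝒰)
    (_ : Z ⊆ ⋃ p ∈ Λ, nameSet (Fseq p.1) p.2),
    ∑' p : Λ, ENNReal.ofReal (Real.exp (-s * ((Fseq p.1.1).card : ℝ)))

/-- `ℳ(Z,𝒰,s,{F n}) = lim_{N→∞} ℳ(Z,𝒰,N,s,{F n})`; the quantity is nondecreasing in `N`,
so the limit is the supremum. -/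
noncomputable def bowenMlim (Fseq : ℕ → Finset G) (𝒰 : Finset (Set X)) (Z : Set X)
    (s : ℝ) : ℝ≥0∞ :=
  ⨆ N : ℕ, bowenM Fseq 𝒰 Z N s

/-- `h^B_top(𝒰,Z,{F n}) = inf {s ≥ 0 : ℳ(Z,𝒰,s,{F n}) = 0}`. -/
noncomputable def bowenEntropyCover (Fseq : ℕ → Finset G) (𝒰 : Finset (Set X)) (Z : Set X) :
    ℝ≥0∞ :=
  ⨅ (s : ℝ≥0) (_ : bowenMlim Fseq 𝒰 Z (s : ℝ) = 0), (s : ℝ≥0∞)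

/-- The Bowen (dimensional) topological entropy
`h^B_top(Z,{F n}) = sup_𝒰 h^B_top(𝒰,Z,{F n})` over finite open covers `𝒰` of `X`. -/
noncomputable def bowenEntropy (Fseq : ℕ → Finset G) (Z : Set X) : ℝ≥0∞ :=
  ⨆ (𝒰 : Finset (Set X)) (_ : IsFiniteOpenCoverOn 𝒰 (Set.univ : Set X)),
    bowenEntropyCover Fseq 𝒰 Z

end Defs

section Covering

variable {G : Type*} [Group G] [DecidableEq G]

/-- The right translate `F g`. -/
def rightTranslate (F : Finset G) (g : G) : Finset G := F.image (fun h => h * g)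

theorem mem_rightTranslate {F : Finset G} {g x : G} :
    x ∈ rightTranslate F g ↔ ∃ h ∈ F, h * g = x := by
  simp only [rightTranslate, Finset.mem_image]

theorem card_rightTranslate (F : Finset G) (g : G) :
    (rightTranslate F g).card = F.card :=
  Finset.card_image_of_injective _ (mul_left_injective g)

/-- Greedy selection of an `ε`-disjoint subfamily of the translates `F (j a) a`, processing larger
indices first: every translate meets a selected one of larger index, or is substantially
covered by the selected ones of the same index. -/
theorem exists_greedy_selection (F : ℕ → Finset G) (j : G → ℕ) {ε : ℝ} (hε1 : ε ≤ 1)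
    (A : Finset G) :
    ∃ S ⊆ A, (1 - ε) * ∑ s ∈ S, ((F (j s)).card : ℝ) ≤
        ((S.biUnion fun s => rightTranslate (F (j s)) s).card : ℝ) ∧
      ∀ a ∈ A, (∃ s ∈ S, j a < j s ∧
          ¬ Disjoint (rightTranslate (F (j a)) a) (rightTranslate (F (j s)) s)) ∨
        ε * ((F (j a)).card : ℝ) ≤ ∑ s ∈ S with j s = j a,
          ((rightTranslate (F (j a)) a ∩ rightTranslate (F (j s)) s).card : ℝ) := by
  induction A using Finset.induction_on_min_value j with
  | empty => exact ⟨∅, by simp, by simp, by simp⟩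
  | insert a A ha hmin ih =>
    obtain ⟨S, hSA, hS, hcov⟩ := ih
    set U := S.biUnion fun s => rightTranslate (F (j s)) s with hU
    by_cases hcase : ((rightTranslate (F (j a)) a ∩ U).card : ℝ) ≤ ε * ((F (j a)).card : ℝ)
    · have haS : a ∉ S := fun h => ha (hSA h)
      refine ⟨insert a S, Finset.insert_subset_insert _ hSA, ?_, ?_⟩
      · rw [Finset.sum_insert haS, Finset.biUnion_insert]
        have h1 := Finset.card_union_add_card_inter (rightTranslate (F (j a)) a) U
        rw [card_rightTranslate] at h1
        have h2 : ((rightTranslate (F (j a)) a ∪ U).card : ℝ) +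
            ((rightTranslate (F (j a)) a ∩ U).card : ℝ) = (F (j a)).card + U.card := by
          exact_mod_cast h1
        linarith
      · intro b hb
        rcases Finset.mem_insert.1 hb with rfl | hb
        · right
          refine le_trans ?_ (Finset.single_le_sum (f := fun s =>
            ((rightTranslate (F (j b)) b ∩ rightTranslate (F (j s)) s).card : ℝ))
            (fun _ _ => Nat.cast_nonneg _) (a := b) (by simp))
          simp only [Finset.inter_self, card_rightTranslate]
          exact mul_le_of_le_one_left (Nat.cast_nonneg _) hε1
        · rcases hcov b hb with ⟨s, hs, h1, h2⟩ | h
          · exact Or.inl ⟨s, Finset.mem_insert_of_mem hs, h1, h2⟩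
          · refine Or.inr (h.trans (Finset.sum_le_sum_of_subset_of_nonneg ?_
              fun _ _ _ => Nat.cast_nonneg _))
            exact Finset.filter_subset_filter _ (Finset.subset_insert _ _)
    · refine ⟨S, hSA.trans (Finset.subset_insert _ _), hS, fun b hb => ?_⟩
      rcases Finset.mem_insert.1 hb with rfl | hb
      · by_contra! hcon
        obtain ⟨h1, h2⟩ := hcon
        apply hcase
        refine le_trans ?_ h2.le
        rw [Finset.sum_filter_of_ne]
        · rw [hU, Finset.inter_biUnion]
          exact_mod_cast Finset.card_biUnion_le
        · intro s hs hne
          by_contra hj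
          have hlt : j b < j s := lt_of_le_of_ne (hmin s (hSA hs)) (Ne.symm hj)
          exact hne (by simp [Finset.disjoint_iff_inter_eq_empty.1 (h1 s hs hlt)])
      · exact hcov b hb

/-- The translates of `F` overlap a given translate `F s` with total weight at most `|F|²`. -/
theorem sum_card_inter_rightTranslate_le (F A : Finset G) (s : G) :
    ∑ a ∈ A, (rightTranslate F a ∩ rightTranslate F s).card ≤ F.card * F.card := by
  calc ∑ a ∈ A, (rightTranslate F a ∩ rightTranslate F s).card
      = ∑ a ∈ A, ∑ x ∈ rightTranslate F s, if x ∈ rightTranslate F a then 1 else 0 := by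
        refine Finset.sum_congr rfl fun a _ => ?_
        rw [Finset.inter_comm, ← Finset.filter_mem_eq_inter, Finset.card_filter]
    _ = ∑ x ∈ rightTranslate F s, (A.filter fun a => x ∈ rightTranslate F a).card := by
        rw [Finset.sum_comm]
        simp only [Finset.card_filter]
    _ ≤ ∑ x ∈ rightTranslate F s, F.card := by
        refine Finset.sum_le_sum fun x _ => ?_
        have : (A.filter fun a => x ∈ rightTranslate F a) ⊆ F.image fun h => h⁻¹ * x := by
          intro a ha
          obtain ⟨h, hh, rfl⟩ := mem_rightTranslate.1 (Finset.mem_filter.1 ha).2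
          exact Finset.mem_image.2 ⟨h, hh, by group⟩
        exact (Finset.card_le_card this).trans Finset.card_image_le
    _ = F.card * F.card := by simp [card_rightTranslate]

/-- Covering lemma for a tempered sequence: an `ε`-disjoint subfamily whose total size
controls the number of centres. -/
theorem exists_almostDisjoint_selection (F : ℕ → Finset G) (hne : ∀ n, (F n).Nonempty) {C : ℝ}
    (hC : ∀ n : ℕ, ((((Finset.range n).biUnion fun k => (F k)⁻¹ * F n)).card : ℝ) ≤
      C * ((F n).card : ℝ))
    (j : G → ℕ) {ε : ℝ} (hε0 : 0 < ε) (hε1 : ε ≤ 1) (A : Finset G) :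
    ∃ S ⊆ A, (1 - ε) * ∑ s ∈ S, ((F (j s)).card : ℝ) ≤
        ((S.biUnion fun s => rightTranslate (F (j s)) s).card : ℝ) ∧
      (A.card : ℝ) ≤ (C + 1 / ε) * ∑ s ∈ S, ((F (j s)).card : ℝ) := by
  obtain ⟨S, hSA, hS, hcov⟩ := exists_greedy_selection F j hε1 A
  refine ⟨S, hSA, hS, ?_⟩
  have hpos : ∀ n, (0 : ℝ) < (F n).card := fun n => by exact_mod_cast (hne n).card_pos
  set A₁ := S.biUnion fun s =>
    rightTranslate ((Finset.range (j s)).biUnion fun k => (F k)⁻¹ * F (j s)) s with hA₁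
  set A₂ := A.filter fun a => ε * ((F (j a)).card : ℝ) ≤ ∑ s ∈ S with j s = j a,
          ((rightTranslate (F (j a)) a ∩ rightTranslate (F (j s)) s).card : ℝ) with hA₂
  have hsub : A ⊆ A₁ ∪ A₂ := by
    intro a ha
    rcases hcov a ha with ⟨s, hs, hlt, hnd⟩ | h
    · refine Finset.mem_union_left _ (Finset.mem_biUnion.2 ⟨s, hs, ?_⟩)
      obtain ⟨x, hx1, hx2⟩ := Finset.not_disjoint_iff.1 hnd
      obtain ⟨h, hh, rfl⟩ := mem_rightTranslate.1 hx1
      obtain ⟨f, hf, hfe⟩ := mem_rightTranslate.1 hx2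
      refine mem_rightTranslate.2 ⟨h⁻¹ * f, ?_, by rw [mul_assoc, hfe]; group⟩
      exact Finset.mem_biUnion.2 ⟨j a, Finset.mem_range.2 hlt,
        Finset.mul_mem_mul (Finset.inv_mem_inv hh) hf⟩
    · exact Finset.mem_union_right _ (Finset.mem_filter.2 ⟨ha, h⟩)
  have h1 : (A₁.card : ℝ) ≤ C * ∑ s ∈ S, ((F (j s)).card : ℝ) := by
    rw [Finset.mul_sum]
    refine (Nat.cast_le.2 Finset.card_biUnion_le).trans ?_
    rw [Nat.cast_sum]
    refine Finset.sum_le_sum fun s _ => ?_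
    rw [card_rightTranslate]
    exact hC (j s)
  have h2 : ε * (A₂.card : ℝ) ≤ ∑ s ∈ S, ((F (j s)).card : ℝ) := by
    calc ε * (A₂.card : ℝ) = ∑ a ∈ A₂, ε := by simp [mul_comm]
      _ ≤ ∑ a ∈ A₂, ∑ s ∈ S, if j s = j a then
            ((rightTranslate (F (j s)) a ∩ rightTranslate (F (j s)) s).card : ℝ) /
              (F (j s)).card else 0 := by
          refine Finset.sum_le_sum fun a ha => ?_
          have := (Finset.mem_filter.1 ha).2
          rw [← le_div_iff₀ (hpos _), Finset.sum_div] at this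
          refine this.trans (le_of_eq ?_)
          rw [Finset.sum_filter]
          refine Finset.sum_congr rfl fun s _ => ?_
          split_ifs with h
          · rw [h]
          · rfl
      _ = ∑ s ∈ S, ∑ a ∈ A₂, if j s = j a then
            ((rightTranslate (F (j s)) a ∩ rightTranslate (F (j s)) s).card : ℝ) /
              (F (j s)).card else 0 := Finset.sum_comm
      _ ≤ ∑ s ∈ S, ((F (j s)).card : ℝ) := by
          refine Finset.sum_le_sum fun s _ => ?_
          calc _ ≤ ∑ a ∈ A₂,
              ((rightTranslate (F (j s)) a ∩ rightTranslate (F (j s)) s).card : ℝ) /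
              (F (j s)).card := by
                refine Finset.sum_le_sum fun a _ => ?_
                split_ifs
                · exact le_rfl
                · positivity
            _ ≤ _ := by
                rw [← Finset.sum_div, div_le_iff₀ (hpos _)]
                exact_mod_cast sum_card_inter_rightTranslate_le (F (j s)) A₂ s
  have h3 : (A.card : ℝ) ≤ A₁.card + A₂.card := by
    exact_mod_cast (Finset.card_le_card hsub).trans (Finset.card_union_le _ _)
  have h4 : (A₂.card : ℝ) ≤ 1 / ε * ∑ s ∈ S, ((F (j s)).card : ℝ) := by
    rw [one_div, inv_mul_eq_div, le_div_iff₀ hε0]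
    linarith
  linarith

/-- Multi-level quasi-tiling: each level `i` assigns to every `g` a tile `F (sh (p i g)) g`. If
higher-level tiles are almost invariant under the lower levels, then `D` can be almost covered by
an almost disjoint family of these tiles. -/
theorem exists_quasiTiling {β : Type*} (F : ℕ → Finset G) (hne : ∀ n, (F n).Nonempty) {C : ℝ}
    (hC0 : 0 < C)
    (hC : ∀ n : ℕ, ((((Finset.range n).biUnion fun k => (F k)⁻¹ * F n)).card : ℝ) ≤
      C * ((F n).card : ℝ))
    {ε δ : ℝ} (hε0 : 0 < ε) (hε1 : ε ≤ 1 / 2) (hδ : 0 ≤ δ)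
    (D : Finset G) (M : ℕ) (sh : β → ℕ) (p : ℕ → G → β) (K : ℕ → Finset G)
    (hK : ∀ i < M, ∀ g, F (sh (p i g)) ⊆ K i)
    (hinv : ∀ i i', i < i' → i' < M → ∀ g,
      ((((K i)⁻¹ * F (sh (p i' g))) \ F (sh (p i' g))).card : ℝ) ≤
        δ * (F (sh (p i' g))).card)
    (hD : ∀ i < M, ((D.filter fun g => ¬ rightTranslate (K i) g ⊆ D).card : ℝ) ≤ δ * D.card)
    (m : ℕ) (hm : m ≤ M) :
    ∃ T : Finset (G × β),
      (∀ t ∈ T, ∃ i, M - m ≤ i ∧ i < M ∧ t.2 = p i t.1) ∧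
      (∀ t ∈ T, t.1 ∈ D ∧ rightTranslate (F (sh t.2)) t.1 ⊆ D) ∧
      (1 - ε) * ∑ t ∈ T, ((F (sh t.2)).card : ℝ) ≤
        ((T.biUnion fun t => rightTranslate (F (sh t.2)) t.1).card : ℝ) ∧
      ((D \ T.biUnion fun t => rightTranslate (F (sh t.2)) t.1).card : ℝ) ≤
        ((1 - (1 - ε) / (C + 1 / ε)) ^ m + 3 * δ) * D.card := by
  classical
  induction m with
  | zero =>
    refine ⟨∅, by simp, by simp, by simp, ?_⟩
    have : (0 : ℝ) ≤ D.card := Nat.cast_nonneg _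
    simp only [Finset.biUnion_empty, Finset.sdiff_empty, pow_zero]
    nlinarith
  | succ m ih =>
    obtain ⟨T, hTlev, hTD, hTdis, hTcov⟩ := ih (by omega)
    set U := T.biUnion fun t => rightTranslate (F (sh t.2)) t.1 with hU
    have hUD : U ⊆ D := Finset.biUnion_subset.2 fun t ht => (hTD t ht).2
    set i := M - (m + 1) with hi
    have hiM : i < M := by omega
    set A := D.filter fun g => rightTranslate (K i) g ⊆ D ∧
      Disjoint (rightTranslate (F (sh (p i g))) g) U with hA
    set B := T.biUnion fun t =>
      rightTranslate (((K i)⁻¹ * F (sh t.2)) \ F (sh t.2)) t.1 with hB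
    have hDcov : D ⊆ (A ∪ D.filter fun g => ¬ rightTranslate (K i) g ⊆ D) ∪ (U ∪ B) := by
      intro g hg
      by_cases h1 : rightTranslate (K i) g ⊆ D
      · by_cases h2 : Disjoint (rightTranslate (F (sh (p i g))) g) U
        · exact Finset.mem_union_left _ (Finset.mem_union_left _
            (Finset.mem_filter.2 ⟨hg, h1, h2⟩))
        · refine Finset.mem_union_right _ ?_
          obtain ⟨x, hx1, hx2⟩ := Finset.not_disjoint_iff.1 h2
          obtain ⟨h, hh, rfl⟩ := mem_rightTranslate.1 hx1
          obtain ⟨t, ht, hx⟩ := Finset.mem_biUnion.1 hx2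
          obtain ⟨f, hf, hfe⟩ := mem_rightTranslate.1 hx
          have hge : h⁻¹ * f * t.1 = g := by rw [mul_assoc, hfe]; group
          by_cases h3 : h⁻¹ * f ∈ F (sh t.2)
          · exact Finset.mem_union_left _ (Finset.mem_biUnion.2
              ⟨t, ht, mem_rightTranslate.2 ⟨_, h3, hge⟩⟩)
          · exact Finset.mem_union_right _ (Finset.mem_biUnion.2
              ⟨t, ht, mem_rightTranslate.2 ⟨_, Finset.mem_sdiff.2
                ⟨Finset.mul_mem_mul (Finset.inv_mem_inv (hK i hiM g hh)) hf, h3⟩, hge⟩⟩)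
      · exact Finset.mem_union_left _ (Finset.mem_union_right _
          (Finset.mem_filter.2 ⟨hg, h1⟩))
    have hDcard : (D.card : ℝ) ≤ A.card +
        (D.filter fun g => ¬ rightTranslate (K i) g ⊆ D).card + (U.card + B.card) := by
      exact_mod_cast (Finset.card_le_card hDcov).trans ((Finset.card_union_le _ _).trans
        (add_le_add (Finset.card_union_le _ _) (Finset.card_union_le _ _)))
    have hBcard : (B.card : ℝ) ≤ δ * ∑ t ∈ T, ((F (sh t.2)).card : ℝ) := by
      rw [Finset.mul_sum]
      refine (Nat.cast_le.2 Finset.card_biUnion_le).trans ?_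
      rw [Nat.cast_sum]
      refine Finset.sum_le_sum fun t ht => ?_
      rw [card_rightTranslate]
      obtain ⟨i', h1, h2, h3⟩ := hTlev t ht
      rw [h3]
      exact hinv i i' (by omega) h2 t.1
    have hUcard : (U.card : ℝ) ≤ D.card := by exact_mod_cast Finset.card_le_card hUD
    have hsum0 : 0 ≤ ∑ t ∈ T, ((F (sh t.2)).card : ℝ) :=
      Finset.sum_nonneg fun _ _ => Nat.cast_nonneg _
    have hsum : ∑ t ∈ T, ((F (sh t.2)).card : ℝ) ≤ 2 * D.card := by nlinarith
    have hB2 : (B.card : ℝ) ≤ δ * (2 * D.card) :=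
      hBcard.trans (mul_le_mul_of_nonneg_left hsum hδ)
    have hDU : ((D \ U).card : ℝ) + U.card = D.card := by
      exact_mod_cast Finset.card_sdiff_add_card_eq_card hUD
    have hAcard : ((D \ U).card : ℝ) - 3 * δ * D.card ≤ A.card := by
      have := hD i hiM
      linarith
    obtain ⟨S, hSA, hSdis, hScard⟩ := exists_almostDisjoint_selection F hne hC
      (fun g => sh (p i g)) hε0 (by linarith) A
    set V := S.biUnion fun s => rightTranslate (F (sh (p i s))) s with hV
    have hUT : (T ∪ S.image fun g => (g, p i g)).biUnion
        (fun t => rightTranslate (F (sh t.2)) t.1) = U ∪ V := by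
      rw [Finset.union_biUnion, Finset.image_biUnion]
    have hVD : V ⊆ D := Finset.biUnion_subset.2 fun s hs => by
      have h1 := (Finset.mem_filter.1 (hSA hs)).2.1
      exact (Finset.image_subset_image (hK i hiM s)).trans h1
    have hVU : Disjoint U V := by
      rw [hV, Finset.disjoint_biUnion_right]
      exact fun s hs => (Finset.mem_filter.1 (hSA hs)).2.2.symm
    have hUV : ((U ∪ V).card : ℝ) = U.card + V.card := by
      exact_mod_cast Finset.card_union_of_disjoint hVU
    have hDUV : ((D \ (U ∪ V)).card : ℝ) + (U ∪ V).card = D.card := by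
      exact_mod_cast Finset.card_sdiff_add_card_eq_card (Finset.union_subset hUD hVD)
    refine ⟨T ∪ S.image fun g => (g, p i g), ?_, ?_, ?_, ?_⟩
    · intro t ht
      rcases Finset.mem_union.1 ht with ht | ht
      · obtain ⟨i', h1, h2, h3⟩ := hTlev t ht
        exact ⟨i', by omega, h2, h3⟩
      · obtain ⟨g, _, rfl⟩ := Finset.mem_image.1 ht
        exact ⟨i, le_rfl, hiM, rfl⟩
    · intro t ht
      rcases Finset.mem_union.1 ht with ht | ht
      · exact hTD t ht
      · obtain ⟨g, hg, rfl⟩ := Finset.mem_image.1 ht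
        have h1 := Finset.mem_filter.1 (hSA hg)
        exact ⟨h1.1, (Finset.image_subset_image (hK i hiM g)).trans h1.2.1⟩
    · rw [hUT, hUV]
      have h1 : ∑ t ∈ T ∪ S.image (fun g => (g, p i g)), ((F (sh t.2)).card : ℝ) ≤
          ∑ t ∈ T, ((F (sh t.2)).card : ℝ) + ∑ s ∈ S, ((F (sh (p i s))).card : ℝ) := by
        have h2 : ∑ t ∈ S.image (fun g => (g, p i g)), ((F (sh t.2)).card : ℝ) =
            ∑ s ∈ S, ((F (sh (p i s))).card : ℝ) :=
          Finset.sum_image fun a _ b _ hab => (Prod.ext_iff.1 hab).1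
        have h3 : 0 ≤ ∑ t ∈ T ∩ S.image (fun g => (g, p i g)), ((F (sh t.2)).card : ℝ) :=
          Finset.sum_nonneg fun _ _ => Nat.cast_nonneg _
        have h4 := Finset.sum_union_inter (s₁ := T) (s₂ := S.image fun g => (g, p i g))
          (f := fun t => ((F (sh t.2)).card : ℝ))
        linarith
      have h5 := mul_le_mul_of_nonneg_left h1 (by linarith : 0 ≤ 1 - ε)
      linarith
    · rw [hUT]
      have hE : 0 < C + 1 / ε := by positivity
      set c := (1 - ε) / (C + 1 / ε) with hc
      have hc0 : 0 ≤ c := div_nonneg (by linarith) hE.le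
      have hc1 : c ≤ 1 := by
        rw [hc, div_le_one hE]
        have : 1 ≤ 1 / ε := by rw [le_div_iff₀ hε0]; linarith
        linarith
      have hcV : c * A.card ≤ V.card := by
        refine le_trans ?_ hSdis
        rw [hc, div_mul_eq_mul_div, div_le_iff₀ hE, mul_assoc]
        refine mul_le_mul_of_nonneg_left ?_ (by linarith)
        rwa [mul_comm]
      have h1 := mul_le_mul_of_nonneg_left hAcard hc0
      have h2 := mul_le_mul_of_nonneg_left hTcov (by linarith : 0 ≤ 1 - c)
      rw [pow_succ]
      nlinarith

end Covering

section Folner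

variable {G : Type*} [Group G] [DecidableEq G]

theorem IsFolnerSeq.eventually_sum_symmDiff_le {F : ℕ → Finset G} (hF : IsFolnerSeq F)
    (K : Finset G) {δ : ℝ} (hδ : 0 < δ) :
    ∀ᶠ n in atTop, ∑ k ∈ K,
      ((symmDiff (F n) ((F n).image (fun h => k⁻¹ * h))).card : ℝ) ≤ δ * (F n).card := by
  have h := tendsto_finsetSum K fun k _ => hF.2 k⁻¹
  rw [Finset.sum_const_zero] at h
  filter_upwards [h.eventually (gt_mem_nhds hδ)] with n hn
  have hpos : (0 : ℝ) < (F n).card := by exact_mod_cast (hF.1 n).card_pos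
  rw [← Finset.sum_div, div_lt_iff₀ hpos] at hn
  exact hn.le

theorem IsFolnerSeq.eventually_card_mul_sdiff_le {F : ℕ → Finset G} (hF : IsFolnerSeq F)
    (K : Finset G) {δ : ℝ} (hδ : 0 < δ) :
    ∀ᶠ n in atTop, (((K⁻¹ * F n) \ F n).card : ℝ) ≤ δ * (F n).card := by
  filter_upwards [hF.eventually_sum_symmDiff_le K hδ] with n hn
  refine le_trans ?_ hn
  have hsub : (K⁻¹ * F n) \ F n ⊆
      K.biUnion fun k => symmDiff (F n) ((F n).image (fun h => k⁻¹ * h)) := by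
    intro x hx
    obtain ⟨hx1, hx2⟩ := Finset.mem_sdiff.1 hx
    obtain ⟨a, ha, f, hf, rfl⟩ := Finset.mem_mul.1 hx1
    refine Finset.mem_biUnion.2 ⟨a⁻¹, Finset.mem_inv'.1 ha, Finset.mem_symmDiff.2 (Or.inr ⟨?_, hx2⟩)⟩
    exact Finset.mem_image.2 ⟨f, hf, by simp⟩
  exact_mod_cast (Finset.card_le_card hsub).trans Finset.card_biUnion_le

theorem IsFolnerSeq.eventually_card_filter_le {F : ℕ → Finset G} (hF : IsFolnerSeq F)
    (K : Finset G) {δ : ℝ} (hδ : 0 < δ) :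
    ∀ᶠ n in atTop, (((F n).filter fun g => ¬ rightTranslate K g ⊆ F n).card : ℝ) ≤
      δ * (F n).card := by
  filter_upwards [hF.eventually_sum_symmDiff_le K hδ] with n hn
  refine le_trans ?_ hn
  have hsub : ((F n).filter fun g => ¬ rightTranslate K g ⊆ F n) ⊆
      K.biUnion fun k => symmDiff (F n) ((F n).image (fun h => k⁻¹ * h)) := by
    intro x hx
    obtain ⟨hx1, hx2⟩ := Finset.mem_filter.1 hx
    obtain ⟨y, hy, hyn⟩ := Finset.not_subset.1 hx2
    obtain ⟨k, hk, rfl⟩ := mem_rightTranslate.1 hy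
    refine Finset.mem_biUnion.2 ⟨k, hk, Finset.mem_symmDiff.2 (Or.inl ⟨hx1, fun h => hyn ?_⟩)⟩
    obtain ⟨f, hf, rfl⟩ := Finset.mem_image.1 h
    simpa using hf
  exact_mod_cast (Finset.card_le_card hsub).trans Finset.card_biUnion_le

theorem IsFolnerSeq.tendsto_card_atTop [Infinite G] {F : ℕ → Finset G} (hF : IsFolnerSeq F) :
    Tendsto (fun n => ((F n).card : ℝ)) atTop atTop := by
  rw [tendsto_atTop]
  intro b
  obtain ⟨m, hm⟩ := exists_nat_ge (2 * b)
  obtain ⟨K, hK⟩ := Infinite.exists_subset_card_eq G m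
  filter_upwards [hF.eventually_card_mul_sdiff_le K one_pos] with n hn
  have h1 : K.card ≤ (K⁻¹ * F n).card := by
    rw [← Finset.card_inv K]
    exact Finset.card_le_card_mul_right (hF.1 n)
  have h2 : (K⁻¹ * F n).card ≤ ((K⁻¹ * F n) \ F n).card + (F n).card :=
    Finset.card_le_card_sdiff_add_card
  have h3 : (m : ℝ) ≤ ((K⁻¹ * F n) \ F n).card + (F n).card := by
    exact_mod_cast hK ▸ h1.trans h2
  linarith

end Folner

section Names

variable {G : Type*} [DecidableEq G] {X : Type*}

open Classical in
/-- All families that take values in `𝒰` on `D` and agree with `base` off `D`. -/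
noncomputable def namesExtending (𝒰 : Finset (Set X)) (D : Finset G) (base : G → Set X) :
    Finset (G → Set X) :=
  (D.pi fun _ => 𝒰).image fun v g => if h : g ∈ D then v g h else base g

theorem card_namesExtending_le (𝒰 : Finset (Set X)) (D : Finset G) (base : G → Set X) :
    (namesExtending 𝒰 D base).card ≤ 𝒰.card ^ D.card := by
  classical
  exact Finset.card_image_le.trans (by simp [Finset.card_pi])

theorem mem_namesExtending {𝒰 : Finset (Set X)} {D : Finset G} {base u : G → Set X} :
    u ∈ namesExtending 𝒰 D base ↔ (∀ g ∈ D, u g ∈ 𝒰) ∧ ∀ g ∉ D, u g = base g := by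
  classical
  constructor
  · intro hu
    obtain ⟨v, hv, rfl⟩ := Finset.mem_image.1 hu
    refine ⟨fun g hg => ?_, fun g hg => by simp [hg]⟩
    simpa [hg] using Finset.mem_pi.1 hv g hg
  · rintro ⟨h1, h2⟩
    refine Finset.mem_image.2 ⟨fun g _ => u g, Finset.mem_pi.2 h1, ?_⟩
    funext g
    by_cases hg : g ∈ D
    · simp [hg]
    · simp [hg, h2 g hg]

variable [Group G] [TopologicalSpace X] [MulAction G X]

theorem exists_card_eq_covNum {𝒰 : Finset (Set X)}
    (h𝒰 : IsFiniteOpenCoverOn 𝒰 (Set.univ : Set X)) (D : Finset G) :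
    ∃ Λ : Finset (G → Set X), Λ.card = covNum 𝒰 D (Set.univ : Set X) ∧
      (∀ u ∈ Λ, ∀ g ∈ D, u g ∈ 𝒰) ∧ (Set.univ : Set X) ⊆ ⋃ u ∈ Λ, nameSet D u := by
  classical
  refine Nat.sInf_mem (s := {k : ℕ | ∃ Λ : Finset (G → Set X), Λ.card = k ∧
    (∀ u ∈ Λ, ∀ g ∈ D, u g ∈ 𝒰) ∧ (Set.univ : Set X) ⊆ ⋃ u ∈ Λ, nameSet D u})
    ⟨_, namesExtending 𝒰 D fun _ => ∅, rfl, fun u hu => (mem_namesExtending.1 hu).1, ?_⟩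
  intro x _
  choose V hV hxV using fun g : G => h𝒰.2 (Set.mem_univ (g • x))
  refine Set.mem_iUnion₂.2 ⟨fun g => if g ∈ D then V g else ∅, mem_namesExtending.2 ⟨?_, ?_⟩, ?_⟩
  · exact fun g hg => by simpa [hg] using hV g
  · exact fun g hg => by simp [hg]
  · exact fun g hg => by simpa [hg] using hxV g

/-- If every point admits a partial covering of `D` by translated names from `Λ` with total length
at most `L`, missing at most `R` elements of `D`, then the number of `(𝒰, D)`-names
needed to cover the space is controlled by the weight of `Λ`. -/
theorem covNum_le_exp {𝒰 : Finset (Set X)} (h𝒰 : IsFiniteOpenCoverOn 𝒰 (Set.univ : Set X))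
    (h𝒰0 : 𝒰.Nonempty) (F : ℕ → Finset G) (Λ : Finset (ℕ × (G → Set X)))
    (hΛ : ∀ p ∈ Λ, ∀ g ∈ F p.1, p.2 g ∈ 𝒰) (D : Finset G) {s L R : ℝ} (hs : 0 ≤ s)
    (hx : ∀ x : X, ∃ P ⊆ D ×ˢ Λ, (∀ t ∈ P, t.1 • x ∈ nameSet (F t.2.1) t.2.2) ∧
      ∑ t ∈ P, ((F t.2.1).card : ℝ) ≤ L ∧
      ((D \ P.biUnion fun t => rightTranslate (F t.2.1) t.1).card : ℝ) ≤ R) :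
    (covNum 𝒰 D (Set.univ : Set X) : ℝ) ≤
      Real.exp (R * Real.log 𝒰.card + s * L +
        D.card * ∑ p ∈ Λ, Real.exp (-s * ((F p.1).card : ℝ))) := by
  classical
  have h𝒰1 : (1 : ℝ) ≤ 𝒰.card := by exact_mod_cast h𝒰0.card_pos
  set good := (D ×ˢ Λ).powerset.filter fun P => ∑ t ∈ P, ((F t.2.1).card : ℝ) ≤ L ∧
      ((D \ P.biUnion fun t => rightTranslate (F t.2.1) t.1).card : ℝ) ≤ R with hgood
  let base : Finset (G × (ℕ × (G → Set X))) → G → Set X := fun P h =>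
    if hh : ∃ t ∈ P, h ∈ rightTranslate (F t.2.1) t.1 then
      hh.choose.2.2 (h * hh.choose.1⁻¹) else ∅
  have hbase : ∀ P h, h ∈ P.biUnion (fun t => rightTranslate (F t.2.1) t.1) →
      ∃ t ∈ P, ∃ f ∈ F t.2.1, f * t.1 = h ∧ base P h = t.2.2 f := by
    intro P h hh
    have hh : ∃ t ∈ P, h ∈ rightTranslate (F t.2.1) t.1 := Finset.mem_biUnion.1 hh
    obtain ⟨f, hf, hfe⟩ := mem_rightTranslate.1 hh.choose_spec.2
    refine ⟨hh.choose, hh.choose_spec.1, f, hf, hfe, ?_⟩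
    simp only [base, dif_pos hh]
    rw [← eq_mul_inv_iff_mul_eq.2 hfe]
  set names := good.biUnion fun P =>
    namesExtending 𝒰 (D \ P.biUnion fun t => rightTranslate (F t.2.1) t.1) (base P) with hnames
  have hcov : covNum 𝒰 D (Set.univ : Set X) ≤ names.card := by
    refine Nat.sInf_le ⟨names, rfl, ?_, ?_⟩
    · intro u hu g hg
      obtain ⟨P, hP, huP⟩ := Finset.mem_biUnion.1 hu
      obtain ⟨h1, h2⟩ := mem_namesExtending.1 huP
      by_cases hgP : g ∈ P.biUnion fun t => rightTranslate (F t.2.1) t.1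
      · rw [h2 g (by simp only [Finset.mem_sdiff, not_and, not_not]; exact fun _ => hgP)]
        obtain ⟨t, ht, f, hf, -, hb⟩ := hbase P g hgP
        rw [hb]
        have := Finset.mem_powerset.1 (Finset.mem_filter.1 hP).1 ht
        exact hΛ t.2 (Finset.mem_product.1 this).2 f hf
      · exact h1 g (Finset.mem_sdiff.2 ⟨hg, hgP⟩)
    · intro x _
      obtain ⟨P, hPs, hPx, hPL, hPR⟩ := hx x
      choose V hV hxV using fun g : G => h𝒰.2 (Set.mem_univ (g • x))
      refine Set.mem_iUnion₂.2 ⟨fun g =>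
        if g ∈ D \ P.biUnion (fun t => rightTranslate (F t.2.1) t.1) then V g else base P g,
        Finset.mem_biUnion.2 ⟨P, Finset.mem_filter.2 ⟨Finset.mem_powerset.2 hPs, hPL, hPR⟩,
          mem_namesExtending.2 ⟨fun g hg => ?_, fun g hg => ?_⟩⟩, fun g hg => ?_⟩
      · simp only [if_pos hg]
        exact hV g
      · simp only [if_neg hg]
      · by_cases hgP : g ∈ P.biUnion fun t => rightTranslate (F t.2.1) t.1
        · have : g ∉ D \ P.biUnion fun t => rightTranslate (F t.2.1) t.1 := by
            simp only [Finset.mem_sdiff, not_and, not_not]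
            exact fun _ => hgP
          simp only [if_neg this]
          obtain ⟨t, ht, f, hf, hfe, hb⟩ := hbase P g hgP
          rw [hb, ← hfe, mul_smul]
          exact hPx t ht f hf
        · simp only [if_pos (Finset.mem_sdiff.2 ⟨hg, hgP⟩)]
          exact hxV g
  have hnamesCard : (names.card : ℝ) ≤ good.card * Real.exp (R * Real.log 𝒰.card) := by
    refine (Nat.cast_le.2 Finset.card_biUnion_le).trans ?_
    rw [Nat.cast_sum, ← nsmul_eq_mul]
    refine Finset.sum_le_card_nsmul _ _ _ fun P hP => ?_
    refine (Nat.cast_le.2 (card_namesExtending_le _ _ _)).trans ?_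
    rw [Nat.cast_pow, ← Real.exp_log (by positivity : (0 : ℝ) < (𝒰.card : ℝ) ^
      (D \ P.biUnion fun t => rightTranslate (F t.2.1) t.1).card), Real.log_pow]
    exact Real.exp_le_exp.2 (mul_le_mul_of_nonneg_right (Finset.mem_filter.1 hP).2.2
      (Real.log_nonneg h𝒰1))
  have hgoodCard : (good.card : ℝ) ≤ Real.exp (s * L) *
      Real.exp (D.card * ∑ p ∈ Λ, Real.exp (-s * ((F p.1).card : ℝ))) := by
    calc (good.card : ℝ) = ∑ P ∈ good, (1 : ℝ) := by simp
      _ ≤ ∑ P ∈ good, Real.exp (s * L) * ∏ t ∈ P, Real.exp (-s * ((F t.2.1).card : ℝ)) := by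
          refine Finset.sum_le_sum fun P hP => ?_
          rw [← Real.exp_sum, ← Finset.mul_sum, ← Real.exp_add]
          refine Real.one_le_exp ?_
          have := mul_le_mul_of_nonneg_left (Finset.mem_filter.1 hP).2.1 hs
          linarith
      _ ≤ ∑ P ∈ (D ×ˢ Λ).powerset,
            Real.exp (s * L) * ∏ t ∈ P, Real.exp (-s * ((F t.2.1).card : ℝ)) :=
          Finset.sum_le_sum_of_subset_of_nonneg (Finset.filter_subset _ _)
            fun _ _ _ => by positivity
      _ = Real.exp (s * L) * ∏ t ∈ D ×ˢ Λ, (1 + Real.exp (-s * ((F t.2.1).card : ℝ))) := by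
          rw [← Finset.mul_sum, Finset.prod_one_add]
      _ ≤ Real.exp (s * L) * Real.exp (∑ t ∈ D ×ˢ Λ, Real.exp (-s * ((F t.2.1).card : ℝ))) := by
          refine mul_le_mul_of_nonneg_left ?_ (Real.exp_pos _).le
          rw [Real.exp_sum]
          refine Finset.prod_le_prod (fun _ _ => by positivity) fun t _ => ?_
          rw [add_comm]
          exact Real.add_one_le_exp _
      _ = _ := by
          simp [Finset.sum_product]
  calc (covNum 𝒰 D (Set.univ : Set X) : ℝ) ≤ names.card := by exact_mod_cast hcov
    _ ≤ good.card * Real.exp (R * Real.log 𝒰.card) := hnamesCard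
    _ ≤ _ := by
        refine (mul_le_mul_of_nonneg_right hgoodCard (Real.exp_pos _).le).trans (le_of_eq ?_)
        rw [← Real.exp_add, ← Real.exp_add]
        ring_nf

end Names

section Entropy

variable {G : Type*} [Group G] {X : Type*} [TopologicalSpace X] [MulAction G X]

theorem isOpen_nameSet [ContinuousConstSMul G X] {D : Finset G} {u : G → Set X}
    (hu : ∀ g ∈ D, IsOpen (u g)) : IsOpen (nameSet D u) := by
  have : nameSet D u = ⋂ g ∈ D, (fun x : X => g • x) ⁻¹' u g := by
    ext x
    simp [nameSet]
  rw [this]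
  exact isOpen_biInter_finset fun g hg => (hu g hg).preimage (continuous_const_smul g)

theorem exists_finset_names_of_bowenMlim_eq_zero [CompactSpace X] [ContinuousConstSMul G X]
    {𝒰 : Finset (Set X)} (h𝒰 : IsFiniteOpenCoverOn 𝒰 (Set.univ : Set X)) {F : ℕ → Finset G}
    {s : ℝ} (h : bowenMlim F 𝒰 (Set.univ : Set X) s = 0) (N : ℕ) {a : ℝ} (ha : 0 < a) :
    ∃ Λ : Finset (ℕ × (G → Set X)), (∀ p ∈ Λ, N ≤ p.1 ∧ ∀ g ∈ F p.1, p.2 g ∈ 𝒰) ∧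
      (∀ x : X, ∃ p ∈ Λ, x ∈ nameSet (F p.1) p.2) ∧
      ∑ p ∈ Λ, Real.exp (-s * ((F p.1).card : ℝ)) ≤ a := by
  classical
  have hN : bowenM F 𝒰 (Set.univ : Set X) N s < ENNReal.ofReal a := by
    have : bowenM F 𝒰 (Set.univ : Set X) N s = 0 := ENNReal.iSup_eq_zero.1 h N
    rw [this]
    exact ENNReal.ofReal_pos.2 ha
  simp only [bowenM, iInf_lt_iff] at hN
  obtain ⟨Γ, hΓ, hΓcov, hΓsum⟩ := hN
  obtain ⟨t, ht⟩ := isCompact_univ.elim_finite_subcover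
    (fun p : Γ => nameSet (F p.1.1) p.1.2)
    (fun p => isOpen_nameSet fun g hg => h𝒰.1 _ ((hΓ p.1 p.2).2 g hg))
    (fun x hx => by
      obtain ⟨p, hp, hxp⟩ := Set.mem_iUnion₂.1 (hΓcov hx)
      exact Set.mem_iUnion.2 ⟨⟨p, hp⟩, hxp⟩)
  refine ⟨t.image Subtype.val, ?_, ?_, ?_⟩
  · intro p hp
    obtain ⟨q, _, rfl⟩ := Finset.mem_image.1 hp
    exact hΓ q.1 q.2
  · intro x
    obtain ⟨p, hp, hxp⟩ := Set.mem_iUnion₂.1 (ht (Set.mem_univ x))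
    exact ⟨p.1, Finset.mem_image_of_mem _ hp, hxp⟩
  · rw [Finset.sum_image fun _ _ _ _ h => Subtype.ext h]
    rw [← ENNReal.ofReal_le_ofReal_iff ha.le,
      ENNReal.ofReal_sum_of_nonneg fun _ _ => (Real.exp_pos _).le]
    exact (ENNReal.sum_le_tsum (f := fun p : Γ =>
      ENNReal.ofReal (Real.exp (-s * ((F p.1.1).card : ℝ)))) t).trans hΓsum.le

theorem sum_biUnion_le_sum_sum {ι β : Type*} [DecidableEq β] (I : Finset ι) (Λ : ι → Finset β)
    {w : β → ℝ} (hw : ∀ b, 0 ≤ w b) : ∑ b ∈ I.biUnion Λ, w b ≤ ∑ i ∈ I, ∑ b ∈ Λ i, w b := by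
  classical
  induction I using Finset.induction_on with
  | empty => simp
  | insert i I hi ih =>
    rw [Finset.biUnion_insert, Finset.sum_insert hi]
    have h1 := Finset.sum_union_inter (s₁ := Λ i) (s₂ := I.biUnion Λ) (f := w)
    have h2 : 0 ≤ ∑ b ∈ Λ i ∩ I.biUnion Λ, w b := Finset.sum_nonneg fun _ _ => hw _
    linarith

variable [DecidableEq G]

/-- A sequence of finite Bowen covers of small weight, each consisting of names
almost invariant under the index sets of the previous ones. -/
theorem exists_seq_finset_names [CompactSpace X] [ContinuousConstSMul G X]
    {𝒰 : Finset (Set X)} (h𝒰 : IsFiniteOpenCoverOn 𝒰 (Set.univ : Set X)) {F : ℕ → Finset G}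
    (hF : IsFolnerSeq F) {s : ℝ} (h : bowenMlim F 𝒰 (Set.univ : Set X) s = 0)
    {a δ : ℝ} (ha : 0 < a) (hδ : 0 < δ) :
    ∃ Λ : ℕ → Finset (ℕ × (G → Set X)),
      (∀ i, (∀ p ∈ Λ i, ∀ g ∈ F p.1, p.2 g ∈ 𝒰) ∧
        (∀ x : X, ∃ p ∈ Λ i, x ∈ nameSet (F p.1) p.2) ∧
        ∑ p ∈ Λ i, Real.exp (-s * ((F p.1).card : ℝ)) ≤ a) ∧
      ∀ i i', i < i' → ∀ p ∈ Λ i',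
        (((((Λ i).biUnion fun q => F q.1)⁻¹ * F p.1) \ F p.1).card : ℝ) ≤ δ * (F p.1).card := by
  classical
  refine exists_seq_of_forall_finset_exists
    (fun Λ : Finset (ℕ × (G → Set X)) => (∀ p ∈ Λ, ∀ g ∈ F p.1, p.2 g ∈ 𝒰) ∧
        (∀ x : X, ∃ p ∈ Λ, x ∈ nameSet (F p.1) p.2) ∧
        ∑ p ∈ Λ, Real.exp (-s * ((F p.1).card : ℝ)) ≤ a)
    (fun Λ Λ' => ∀ p ∈ Λ',
        ((((Λ.biUnion fun q => F q.1)⁻¹ * F p.1) \ F p.1).card : ℝ) ≤ δ * (F p.1).card)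
    fun 𝒮 _ => ?_
  have hev : ∀ᶠ n in atTop, ∀ Λ ∈ 𝒮,
      ((((Λ.biUnion fun q => F q.1)⁻¹ * F n) \ F n).card : ℝ) ≤ δ * (F n).card :=
    (Filter.eventually_all_finset 𝒮).2 fun Λ _ => hF.eventually_card_mul_sdiff_le _ hδ
  obtain ⟨N, hN⟩ := eventually_atTop.1 hev
  obtain ⟨Λ, h1, h2, h3⟩ := exists_finset_names_of_bowenMlim_eq_zero h𝒰 h N ha
  exact ⟨Λ, ⟨fun p hp => (h1 p hp).2, h2, h3⟩, fun Λ' hΛ' p hp => hN p.1 (h1 p hp).1 Λ' hΛ'⟩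

theorem eventually_log_covNum_le [CompactSpace X] [ContinuousConstSMul G X]
    {𝒰 : Finset (Set X)} (h𝒰 : IsFiniteOpenCoverOn 𝒰 (Set.univ : Set X)) {F : ℕ → Finset G}
    (hF : IsFolnerSeq F) (hT : IsTemperedSeq F) {s : ℝ} (hs : 0 ≤ s)
    (h : bowenMlim F 𝒰 (Set.univ : Set X) s = 0) {θ : ℝ} (hθ : 0 < θ) :
    ∀ᶠ n in atTop,
      Real.log (covNum 𝒰 (F n) (Set.univ : Set X)) / ((F n).card : ℝ) ≤ s + θ := by
  classical
  rcases isEmpty_or_nonempty X with hX | ⟨⟨x₀⟩⟩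
  · refine Eventually.of_forall fun n => ?_
    have : covNum 𝒰 (F n) (Set.univ : Set X) = 0 :=
      Nat.le_zero.1 (Nat.sInf_le ⟨∅, rfl, by simp, fun x _ => (hX.false x).elim⟩)
    rw [this]
    simp only [Nat.cast_zero, Real.log_zero, zero_div]
    positivity
  have h𝒰0 : 𝒰.Nonempty := by
    obtain ⟨V, hV, -⟩ := h𝒰.2 (Set.mem_univ x₀)
    exact ⟨V, hV⟩
  obtain ⟨C, hC0, hC⟩ := hT
  have hl : 0 ≤ Real.log 𝒰.card := Real.log_natCast_nonneg _
  obtain ⟨ε, hε0, hε1, hε2⟩ : ∃ ε : ℝ, 0 < ε ∧ ε ≤ 1 / 2 ∧ (2 * s + 1) * ε ≤ θ / 2 := by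
    refine ⟨min (1 / 2) (θ / 2 / (2 * s + 1)), by positivity, min_le_left _ _, ?_⟩
    rw [← le_div_iff₀' (by positivity)]
    exact min_le_right _ _
  obtain ⟨η, hη0, hη⟩ : ∃ η : ℝ, 0 < η ∧ η * Real.log 𝒰.card ≤ θ / 2 := by
    refine ⟨θ / 2 / (Real.log 𝒰.card + 1), by positivity, ?_⟩
    rw [div_mul_eq_mul_div, div_le_iff₀ (by positivity)]
    nlinarith
  set c := (1 - ε) / (C + 1 / ε) with hc
  have hc0 : 0 < c := div_pos (by linarith) (by positivity)
  obtain ⟨M, hM⟩ := exists_pow_lt_of_lt_one (half_pos hη0) (by linarith : 1 - c < 1)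
  have hδ : 0 < η / 6 := by positivity
  obtain ⟨Λ, hΛ, hinv⟩ := exists_seq_finset_names h𝒰 hF h
    (a := ε / (M + 1)) (by positivity) hδ
  set K : ℕ → Finset G := fun i => (Λ i).biUnion fun q => F q.1 with hK
  set Γ := (Finset.range M).biUnion Λ with hΓ
  have hweight : ∑ p ∈ Γ, Real.exp (-s * ((F p.1).card : ℝ)) ≤ ε := by
    refine (sum_biUnion_le_sum_sum _ _ fun _ => (Real.exp_pos _).le).trans ?_
    refine (Finset.sum_le_card_nsmul _ _ _ fun i _ => (hΛ i).2.2).trans ?_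
    rw [Finset.card_range, nsmul_eq_mul, ← mul_div_assoc, div_le_iff₀ (by positivity)]
    linarith
  have hev : ∀ᶠ n in atTop, ∀ i ∈ Finset.range M,
      (((F n).filter fun g => ¬ rightTranslate (K i) g ⊆ F n).card : ℝ) ≤ η / 6 * (F n).card :=
    (Filter.eventually_all_finset _).2 fun i _ => hF.eventually_card_filter_le _ hδ
  filter_upwards [hev] with n hn
  have hpos : (0 : ℝ) < (F n).card := by exact_mod_cast (hF.1 n).card_pos
  have key := covNum_le_exp h𝒰 h𝒰0 F Γ
    (fun p hp => by
      obtain ⟨i, -, hp⟩ := Finset.mem_biUnion.1 hp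
      exact (hΛ i).1 p hp)
    (F n) (s := s) (L := (1 + 2 * ε) * (F n).card) (R := η * (F n).card) hs ?_
  · rcases (Nat.cast_nonneg (α := ℝ) (covNum 𝒰 (F n) (Set.univ : Set X))).eq_or_lt with h0 | h0
    · rw [← h0]
      simp only [Real.log_zero, zero_div]
      positivity
    · rw [div_le_iff₀ hpos]
      refine ((Real.log_le_iff_le_exp h0).2 key).trans ?_
      have h1 := mul_le_mul_of_nonneg_left hweight hpos.le
      have h2 : η * Real.log 𝒰.card + s * (1 + 2 * ε) + ε ≤ s + θ := by linarith
      have h3 := mul_le_mul_of_nonneg_left h2 hpos.le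
      linarith
  · intro x
    choose p hpΛ hpx using fun (i : ℕ) (g : G) => (hΛ i).2.1 (g • x)
    obtain ⟨T, hT1, hT2, hT3, hT4⟩ := exists_quasiTiling F hF.1 hC0 hC hε0 hε1 hδ.le (F n) M
      Prod.fst p K
      (fun i _ g => Finset.subset_biUnion_of_mem (fun q : ℕ × (G → Set X) => F q.1) (hpΛ i g))
      (fun i i' hii _ g => hinv i i' hii _ (hpΛ i' g))
      (fun i hi => hn i (Finset.mem_range.2 hi)) M le_rfl
    refine ⟨T, fun t ht => ?_, fun t ht => ?_, ?_, ?_⟩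
    · obtain ⟨i, -, hi, hti⟩ := hT1 t ht
      refine Finset.mem_product.2 ⟨(hT2 t ht).1, Finset.mem_biUnion.2
        ⟨i, Finset.mem_range.2 hi, ?_⟩⟩
      rw [hti]
      exact hpΛ i t.1
    · obtain ⟨i, -, -, hti⟩ := hT1 t ht
      rw [hti]
      exact hpx i t.1
    · have h1 : ((T.biUnion fun t => rightTranslate (F t.2.1) t.1).card : ℝ) ≤ (F n).card := by
        exact_mod_cast Finset.card_le_card (Finset.biUnion_subset.2 fun t ht => (hT2 t ht).2)
      have h2 := hT3.trans h1
      have h3 : 1 ≤ (1 + 2 * ε) * (1 - ε) := by nlinarith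
      have h4 : 0 ≤ ∑ t ∈ T, ((F t.2.1).card : ℝ) := Finset.sum_nonneg fun _ _ => Nat.cast_nonneg _
      have h5 := mul_le_mul_of_nonneg_left h2 (by linarith : 0 ≤ 1 + 2 * ε)
      nlinarith
    · refine hT4.trans (mul_le_mul_of_nonneg_right ?_ hpos.le)
      linarith

theorem coverEntropyOf_le_bowenEntropyCover [CompactSpace X] [ContinuousConstSMul G X]
    {𝒰 : Finset (Set X)} (h𝒰 : IsFiniteOpenCoverOn 𝒰 (Set.univ : Set X)) {F : ℕ → Finset G}
    (hF : IsFolnerSeq F) (hT : IsTemperedSeq F) :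
    coverEntropyOf F 𝒰 (Set.univ : Set X) ≤ bowenEntropyCover F 𝒰 (Set.univ : Set X) := by
  refine le_iInf₂ fun s hs => ENNReal.le_of_forall_pos_le_add fun θ hθ _ => ?_
  refine Filter.limsup_le_of_le (by isBoundedDefault) ?_
  filter_upwards [eventually_log_covNum_le h𝒰 hF hT s.2 hs (NNReal.coe_pos.2 hθ)] with n hn
  rwa [← ENNReal.coe_add, ENNReal.ofReal_le_iff_le_toReal ENNReal.coe_ne_top,
    ENNReal.coe_toReal, NNReal.coe_add]

theorem bowenEntropyCover_le_coverEntropyOf [Infinite G]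
    {𝒰 : Finset (Set X)} (h𝒰 : IsFiniteOpenCoverOn 𝒰 (Set.univ : Set X)) {F : ℕ → Finset G}
    (hF : IsFolnerSeq F) :
    bowenEntropyCover F 𝒰 (Set.univ : Set X) ≤ coverEntropyOf F 𝒰 (Set.univ : Set X) := by
  classical
  refine le_of_forall_gt fun r hr => ?_
  obtain ⟨r', hr', hr'r⟩ := exists_between hr
  obtain ⟨s, hs, hsr⟩ := ENNReal.lt_iff_exists_nnreal_btwn.1 hr'
  obtain ⟨s', hss', hs'r⟩ := ENNReal.lt_iff_exists_nnreal_btwn.1 (hsr.trans hr'r)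
  refine lt_of_le_of_lt ?_ hs'r
  refine iInf₂_le s' ?_
  have hlt : (s : ℝ) < s' := by exact_mod_cast hss'
  have hlim : Tendsto (fun n => ENNReal.ofReal (Real.exp (((s : ℝ) - s') * (F n).card)))
      atTop (𝓝 0) := by
    rw [← ENNReal.ofReal_zero]
    refine ENNReal.tendsto_ofReal (Real.tendsto_exp_atBot.comp ?_)
    exact hF.tendsto_card_atTop.const_mul_atTop_of_neg (by linarith)
  refine ENNReal.iSup_eq_zero.2 fun N => le_antisymm (ge_of_tendsto hlim ?_) bot_le
  filter_upwards [Filter.eventually_lt_of_limsup_lt hs (by isBoundedDefault),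
    eventually_ge_atTop N] with n hn hnN
  obtain ⟨Λ, hcard, hΛ, hcov⟩ := exists_card_eq_covNum h𝒰 (F n)
  have hpos : (0 : ℝ) < (F n).card := by exact_mod_cast (hF.1 n).card_pos
  have hcovNum : (covNum 𝒰 (F n) (Set.univ : Set X) : ℝ) ≤ Real.exp (s * (F n).card) := by
    rcases (Nat.cast_nonneg (α := ℝ) (covNum 𝒰 (F n) (Set.univ : Set X))).eq_or_lt with h0 | h0
    · rw [← h0]
      exact (Real.exp_pos _).le
    · rw [← Real.log_le_iff_le_exp h0, ← div_le_iff₀ hpos]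
      have := (ENNReal.ofReal_le_iff_le_toReal ENNReal.coe_ne_top).1 hn.le
      simpa using this
  refine iInf_le_of_le ((fun u => (n, u)) '' (Λ : Set (G → Set X))) (iInf_le_of_le ?_
    (iInf_le_of_le ?_ ?_))
  · rintro _ ⟨u, hu, rfl⟩
    exact ⟨hnN, hΛ u hu⟩
  · intro x hx
    obtain ⟨u, hu, hxu⟩ := Set.mem_iUnion₂.1 (hcov hx)
    exact Set.mem_iUnion₂.2 ⟨(n, u), ⟨u, hu, rfl⟩, hxu⟩
  · rw [tsum_image (g := fun u : G → Set X => (n, u)) (s := (Λ : Set (G → Set X)))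
      (f := fun p : ℕ × (G → Set X) =>
      ENNReal.ofReal (Real.exp (-(s' : ℝ) * ((F p.1).card : ℝ))))
      fun _ _ _ _ h => (Prod.ext_iff.1 h).2]
    rw [Finset.tsum_subtype' Λ (fun u : G → Set X =>
      ENNReal.ofReal (Real.exp (-(s' : ℝ) * ((F n).card : ℝ)))), Finset.sum_const, hcard,
      ← ENNReal.ofReal_nsmul]
    refine ENNReal.ofReal_le_ofReal ?_
    rw [nsmul_eq_mul, sub_mul, sub_eq_add_neg, Real.exp_add, ← neg_mul]
    exact mul_le_mul_of_nonneg_right hcovNum (Real.exp_pos _).le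

end Entropy

/-- **Main theorem** (Dou–Zhang). For a continuous action of a countably infinite (discrete)
amenable group `G` on a compact Hausdorff space `X` and any tempered Følner sequence
`{F n}` in `G`, the Bowen dimensional entropy of the whole space equals the topological
entropy: `h^B_top(X,{F n}) = h_top(X,G)`. -/
theorem bowenEntropy_univ_eq_topEntropy
    {G : Type*} [Group G] [DecidableEq G] [Countable G] [Infinite G]
    (X : Type*) [TopologicalSpace X] [CompactSpace X] [T2Space X]
    [MulAction G X] [ContinuousConstSMul G X]
    (Fseq : ℕ → Finset G) (hFol : IsFolnerSeq Fseq) (hTemp : IsTemperedSeq Fseq) :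
    bowenEntropy Fseq (Set.univ : Set X) = topEntropy X Fseq :=
  iSup_congr fun _ => iSup_congr fun h𝒰 => le_antisymm (bowenEntropyCover_le_coverEntropyOf h𝒰 hFol)
    (coverEntropyOf_le_bowenEntropyCover h𝒰 hFol hTemp)
end

section
/- Let 0 ≤ δ < 1 and let 𝓕 be a finite δ-disjoint collection of nonempty finite sets. Then ∑_{A∈𝓕} |A| ≤ (1/(1−δ)) |⋃𝓕|. -/
/-- A collection `𝓕` of finite sets is `δ`-disjoint if for every `A ∈ 𝓕` there exists
`A' ⊆ A` with `|A'| ≥ (1-δ)|A|` such that the sets `A'` (for `A ∈ 𝓕`) are pairwise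
disjoint. -/
def DeltaDisjoint {β : Type*} (δ : ℝ) (𝓕 : Finset (Finset β)) : Prop :=
  ∃ core : Finset β → Finset β,
    (∀ A ∈ 𝓕, core A ⊆ A ∧ (1 - δ) * (A.card : ℝ) ≤ ((core A).card : ℝ)) ∧
    (↑𝓕 : Set (Finset β)).Pairwise fun A B => Disjoint (core A) (core B)

/-- If `0 ≤ δ < 1` and `𝓕` is a finite `δ`-disjoint collection of nonempty finite sets,
then `∑_{A ∈ 𝓕} |A| ≤ (1/(1-δ)) |⋃ 𝓕|`. -/
theorem sum_card_le_of_deltaDisjoint {β : Type*} [DecidableEq β]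
    (δ : ℝ) (hδ0 : 0 ≤ δ) (hδ1 : δ < 1)
    (𝓕 : Finset (Finset β)) (hdisj : DeltaDisjoint δ 𝓕) (hne : ∀ A ∈ 𝓕, A.Nonempty) :
    ∑ A ∈ 𝓕, (A.card : ℝ) ≤ (1 / (1 - δ)) * ((𝓕.biUnion id).card : ℝ) := by
  obtain ⟨core, hcore, hpair⟩ := hdisj
  rw [one_div_mul_eq_div, le_div_iff₀' (sub_pos.2 hδ1), Finset.mul_sum]
  calc ∑ A ∈ 𝓕, (1 - δ) * (A.card : ℝ)
      ≤ ∑ A ∈ 𝓕, ((core A).card : ℝ) := Finset.sum_le_sum fun A hA => (hcore A hA).2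
    _ = ((𝓕.biUnion core).card : ℝ) := by
      rw [Finset.card_biUnion hpair, Nat.cast_sum]
    _ ≤ ((𝓕.biUnion id).card : ℝ) := by
      exact_mod_cast Finset.card_le_card
        (Finset.biUnion_mono fun A hA => (hcore A hA).1)
end

section
/- Let G be a countably infinite discrete amenable group acting continuously on a compact metric space (X,d), and let {F_n} be a Følner sequence in G. Then the Bowen dimensional entropy defined via finite open covers coincides with the one defined via Bowen balls: for every Z ⊆ X, h^B_top(Z,{F_n}) equals the critical value of s at which ℳ(Z,s,{F_n}) jumps from +∞ to 0, where ℳ(Z,s,{F_n}) = lim_{ε→0} lim_{N→∞} inf ∑_i exp(−s|F_{n_i}|), the infimum over countable families {B_{F_{n_i}}(x_i,ε)} with x_i ∈ X, n_i ≥ N and ⋃_i B_{F_{n_i}}(x_i,ε) ⊇ Z. -/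
/-!
Bowen (dimensional) topological entropy for actions of countably infinite amenable groups,
and the theorem that it equals the usual topological entropy along any tempered Følner
sequence (Theorem 1.1 of Dou–Zhang).
-/

open Filter Topology Pointwise Set
open scoped ENNReal NNReal

section BallDefs

variable {G : Type*} [Group G] [DecidableEq G]
variable {X : Type*} [MetricSpace X] [MulAction G X]

/-- The Bowen ball `B_F(x,ε) = {y : d(gx,gy) < ε for all g ∈ F}`. -/
def bowenBall (F : Finset G) (x : X) (ε : ℝ) : Set X :=
  {y : X | ∀ g ∈ F, dist (g • x) (g • y) < ε}

/-- `ℳ(Z,N,ε,s,{F n})`: the infimum of `∑_i exp(-s |F_{n_i}|)` over countable families of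
Bowen balls `{B_{F_{n_i}}(x_i,ε)}` with `n_i ≥ N` covering `Z`. -/
noncomputable def bowenBallM (Fseq : ℕ → Finset G) (Z : Set X) (N : ℕ) (ε : ℝ) (s : ℝ) :
    ℝ≥0∞ :=
  ⨅ (Λ : Set (ℕ × X)) (_ : Λ.Countable) (_ : ∀ p ∈ Λ, N ≤ p.1)
    (_ : Z ⊆ ⋃ p ∈ Λ, bowenBall (Fseq p.1) p.2 ε),
    ∑' p : Λ, ENNReal.ofReal (Real.exp (-s * ((Fseq p.1.1).card : ℝ)))

/-- `ℳ(Z,s,{F n}) = lim_{ε→0} lim_{N→∞} ℳ(Z,N,ε,s,{F n})`; both limits are monotone,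
so they are suprema. -/
noncomputable def bowenBallMlim (Fseq : ℕ → Finset G) (Z : Set X) (s : ℝ) : ℝ≥0∞ :=
  ⨆ (ε : ℝ) (_ : 0 < ε), ⨆ N : ℕ, bowenBallM Fseq Z N ε s

/-- The Bowen dimensional entropy defined via Bowen balls: the critical value of `s` at
which `ℳ(Z,s,{F n})` jumps from `+∞` to `0`, i.e. `inf {s ≥ 0 : ℳ(Z,s,{F n}) = 0}`. -/
noncomputable def bowenBallEntropy (Fseq : ℕ → Finset G) (Z : Set X) : ℝ≥0∞ :=
  ⨅ (s : ℝ≥0) (_ : bowenBallMlim Fseq Z (s : ℝ) = 0), (s : ℝ≥0∞)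

end BallDefs

theorem ENNReal.tsum_range_le_tsum {ι β : Type*} (f : ι → β) (w : β → ℝ≥0∞) :
    ∑' q : Set.range f, w q ≤ ∑' i, w (f i) := by
  choose σ hσ using fun q : Set.range f => q.2
  have hinj : Function.Injective σ := fun a b hab =>
    Subtype.ext (by rw [← hσ a, ← hσ b, hab])
  calc ∑' q : Set.range f, w q = ∑' q : Set.range f, w (f (σ q)) := by simp only [hσ]
    _ ≤ ∑' i, w (f i) := ENNReal.tsum_comp_le_tsum_of_injective hinj fun i => w (f i)

section Comparison

variable {G : Type*} {X : Type*} [Group G] [MetricSpace X] [MulAction G X]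

/-- If every `ε`-ball lies in a member of `𝒰`, families of Bowen `ε`-balls refine to families
of `𝒰`-names. -/
theorem bowenM_le_bowenBallM (Fseq : ℕ → Finset G) {𝒰 : Finset (Set X)} {ε : ℝ}
    (h𝒰 : ∀ x : X, ∃ V ∈ 𝒰, Metric.ball x ε ⊆ V) (Z : Set X) (N : ℕ) (s : ℝ) :
    bowenM Fseq 𝒰 Z N s ≤ bowenBallM Fseq Z N ε s := by
  choose V hV hball using h𝒰
  refine le_iInf fun Λ => le_iInf fun _ => le_iInf fun hN => le_iInf fun hZ => ?_
  let f : Λ → ℕ × (G → Set X) := fun p => (p.1.1, fun g => V (g • p.1.2))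
  refine iInf_le_of_le (Set.range f) (iInf_le_of_le ?_ (iInf_le_of_le ?_
    (ENNReal.tsum_range_le_tsum f
      fun q => ENNReal.ofReal (Real.exp (-s * ((Fseq q.1).card : ℝ))))))
  · rintro _ ⟨p, rfl⟩
    exact ⟨hN p p.2, fun g _ => hV _⟩
  · intro z hz
    obtain ⟨p, hp, hzp⟩ := Set.mem_iUnion₂.1 (hZ hz)
    refine Set.mem_iUnion₂.2 ⟨f ⟨p, hp⟩, ⟨_, rfl⟩, fun g hg => hball _ ?_⟩
    exact Metric.mem_ball'.2 (hzp g hg)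

/-- If the members of `𝒰` have diameter less than `ε`, each nonempty name set lies in a Bowen
`ε`-ball. -/
theorem bowenBallM_le_bowenM (Fseq : ℕ → Finset G) {𝒰 : Finset (Set X)} {ε : ℝ}
    (h𝒰 : ∀ V ∈ 𝒰, ∀ x ∈ V, ∀ y ∈ V, dist x y < ε) (Z : Set X) (N : ℕ) (s : ℝ) :
    bowenBallM Fseq Z N ε s ≤ bowenM Fseq 𝒰 Z N s := by
  refine le_iInf fun Λ => le_iInf fun hΛ => le_iInf fun hZ => ?_
  let w : ℕ → ℝ≥0∞ := fun n => ENNReal.ofReal (Real.exp (-s * ((Fseq n).card : ℝ)))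
  change _ ≤ ∑' p : Λ, w p.1.1
  by_cases htop : ∑' p : Λ, w p.1.1 = ⊤
  · exact htop ▸ le_top
  have hΛc : Λ.Countable := by
    have hsupp := Summable.countable_support_ennreal htop
    have huniv : Function.support (fun p : Λ => w p.1.1) = Set.univ :=
      Set.eq_univ_of_forall fun p => (ENNReal.ofReal_pos.2 (Real.exp_pos _)).ne'
    rw [huniv] at hsupp
    exact Set.countable_coe_iff.1 (Set.countable_univ_iff.1 hsupp)
  let S : Set (ℕ × (G → Set X)) := {p ∈ Λ | (nameSet (Fseq p.1) p.2).Nonempty}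
  have hSΛ : S ⊆ Λ := fun p hp => hp.1
  choose x hx using fun p : S => p.2.2
  let f : S → ℕ × X := fun p => (p.1.1, x p)
  have : Countable S := (hΛc.mono hSΛ).to_subtype
  refine iInf_le_of_le (Set.range f) (iInf_le_of_le (Set.countable_range f)
    (iInf_le_of_le ?_ (iInf_le_of_le ?_
      ((ENNReal.tsum_range_le_tsum f fun q => w q.1).trans
        (ENNReal.tsum_mono_subtype (fun p : ℕ × (G → Set X) => w p.1) hSΛ)))))
  · rintro _ ⟨p, rfl⟩
    exact (hΛ p p.2.1).1
  · intro z hz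
    obtain ⟨p, hp, hzp⟩ := Set.mem_iUnion₂.1 (hZ hz)
    let q : S := ⟨p, hp, z, hzp⟩
    exact Set.mem_iUnion₂.2 ⟨f q, ⟨q, rfl⟩, fun g hg =>
      h𝒰 _ ((hΛ p hp).2 g hg) _ (hx q g hg) _ (hzp g hg)⟩

end Comparison

theorem bowenM_antitone {G X : Type*} [Group G] [TopologicalSpace X] [MulAction G X]
    (Fseq : ℕ → Finset G) (𝒰 : Finset (Set X)) (Z : Set X) (N : ℕ) :
    Antitone (bowenM Fseq 𝒰 Z N) := by
  intro s t hst
  refine iInf_mono fun Λ => iInf_mono fun _ => iInf_mono fun _ => ENNReal.tsum_le_tsum fun p => ?_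
  gcongr

theorem exists_finiteOpenCover_dist_lt (X : Type*) [MetricSpace X] [CompactSpace X] {ε : ℝ}
    (hε : 0 < ε) :
    ∃ 𝒰 : Finset (Set X), IsFiniteOpenCoverOn 𝒰 (Set.univ : Set X) ∧
      ∀ V ∈ 𝒰, ∀ x ∈ V, ∀ y ∈ V, dist x y < ε := by
  classical
  obtain ⟨t, -, htf, ht⟩ := Metric.finite_approx_of_totallyBounded
    (isCompact_univ (X := X)).totallyBounded (ε / 2) (half_pos hε)
  refine ⟨htf.toFinset.image fun x => Metric.ball x (ε / 2), ⟨?_, ?_⟩, ?_⟩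
  · intro V hV
    obtain ⟨c, -, rfl⟩ := Finset.mem_image.1 hV
    exact Metric.isOpen_ball
  · intro z hz
    obtain ⟨c, hc, hzc⟩ := Set.mem_iUnion₂.1 (ht hz)
    exact ⟨_, Finset.mem_coe.2 (Finset.mem_image_of_mem _ (htf.mem_toFinset.2 hc)), hzc⟩
  · intro V hV x hx y hy
    obtain ⟨c, -, rfl⟩ := Finset.mem_image.1 hV
    linarith [dist_triangle_right x y c, Metric.mem_ball.1 hx, Metric.mem_ball.1 hy]

/-- For a continuous action of a countably infinite (discrete) amenable group `G` on a
compact metric space `(X,d)` and a Følner sequence `{F n}` in `G`, the Bowen dimensional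
entropy defined via finite open covers coincides, on every subset `Z ⊆ X`, with the one
defined via Bowen balls. -/
theorem bowenEntropy_eq_bowenBallEntropy
    {G : Type*} [Group G] [DecidableEq G] [Countable G] [Infinite G]
    (X : Type*) [MetricSpace X] [CompactSpace X]
    [MulAction G X] [ContinuousConstSMul G X]
    (Fseq : ℕ → Finset G) (hFol : IsFolnerSeq Fseq) (Z : Set X) :
    bowenEntropy Fseq Z = bowenBallEntropy Fseq Z := by
  apply le_antisymm
  · refine iSup₂_le fun 𝒰 h𝒰 => le_iInf₂ fun s hs => iInf₂_le s ?_
    obtain ⟨δ, hδ, hball⟩ := lebesgue_number_lemma_of_metric_sUnion isCompact_univ h𝒰.1 h𝒰.2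
    have hle : bowenMlim Fseq 𝒰 Z s ≤ bowenBallMlim Fseq Z s :=
      (iSup_mono fun N =>
        bowenM_le_bowenBallM Fseq (fun x => hball x (Set.mem_univ x)) Z N s).trans
        (le_iSup₂ (f := fun (ε : ℝ) (_ : 0 < ε) => ⨆ N : ℕ, bowenBallM Fseq Z N ε s) δ hδ)
    exact le_antisymm (hle.trans hs.le) zero_le
  · refine ENNReal.le_of_forall_nnreal_lt fun r hr => ?_
    by_contra! hlt
    have hzero : bowenBallMlim Fseq Z (r : ℝ) ≠ 0 := fun h =>
      hr.not_ge (iInf₂_le r h)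
    refine hzero (le_antisymm ?_ zero_le)
    refine iSup₂_le fun ε hε => iSup_le fun N => ?_
    obtain ⟨𝒰, h𝒰, hdist⟩ := exists_finiteOpenCover_dist_lt X hε
    have hcov : bowenEntropyCover Fseq 𝒰 Z < r :=
      (le_iSup₂ (f := fun (𝒰 : Finset (Set X)) (_ : IsFiniteOpenCoverOn 𝒰 Set.univ) =>
        bowenEntropyCover Fseq 𝒰 Z) 𝒰 h𝒰).trans_lt hlt
    simp only [bowenEntropyCover, iInf_lt_iff] at hcov
    obtain ⟨s, hs, hsr⟩ := hcov
    calc bowenBallM Fseq Z N ε r ≤ bowenM Fseq 𝒰 Z N r := bowenBallM_le_bowenM Fseq hdist Z N r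
      _ ≤ bowenM Fseq 𝒰 Z N s :=
        bowenM_antitone Fseq 𝒰 Z N (NNReal.coe_le_coe.2 (ENNReal.coe_lt_coe.1 hsr).le)
      _ ≤ 0 := (le_iSup (fun N => bowenM Fseq 𝒰 Z N s) N).trans hs.le
end
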